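/- Fix integers m ≥ 2 and ℓ ≥ 1. For each positive integer q let S_q = {x_0 < x_1 < … < x_{T(q)−1}} ⊆ Z_q be a subset of size T(q) satisfying (log log log q / log log q)·q ≤ T(q) ≤ q, T(q) = (1 − 2^{−1/(m−1)})·q + o(q), and C(S_q, q, ℓ log log q) = o( T(q) / (log q)^{ℓ} ) as q → ∞, and let (t_n) be the binary sequence with t_n = 1 if 1 ≤ x_{n+1} − x_n ≤ m−1 and t_n = 0 otherwise, n = 0,…,T(q)−2. Then for every pattern (b_0,…,b_{ℓ−1}) ∈ {0,1}^ℓ, the number of n ∈ {0,…,T(q)−ℓ−1} with t_{n+i} = b_i for all i = 0,…,ℓ−1 equals (2^{−ℓ} + o(1))·T(q) as q → ∞; that is, (t_n) has asymptotically uniform pattern distribution of length ℓ. -/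

import Mathlib

open Finset Filter

/-- The function `f_R` from the paper: `1 - |R|/q` on `R`, `-|R|/q` off `R`. -/
noncomputable def fsub (q : ℕ) (R : Finset ℕ) (n : ℕ) : ℝ :=
  if n % q ∈ R then 1 - (R.card : ℝ) / q else -((R.card : ℝ) / q)

/-- The correlation measure `C_k(R,q)` of order `k` of a subset `R ⊆ Z_q`. -/
noncomputable def corrK (R : Finset ℕ) (q k : ℕ) : ℝ :=
  sSup {x : ℝ | ∃ (M : ℕ) (d : Fin k → ℕ), 1 ≤ M ∧ M ≤ q ∧ StrictMono d ∧
    (∀ i, d i ≤ q - 1) ∧ x = |∑ n ∈ Finset.range M, ∏ i, fsub q R (n + d i)|}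

/-- `C(R,q,s) = max_{1 ≤ k ≤ s} C_k(R,q)`. -/
noncomputable def corrMeasure (R : Finset ℕ) (q s : ℕ) : ℝ :=
  sSup {x : ℝ | ∃ k, 1 ≤ k ∧ k ≤ s ∧ x = corrK R q k}

lemma abs_fsub_le_one {q : ℕ} {R : Finset ℕ} (hR : R.card ≤ q) (n : ℕ) : |fsub q R n| ≤ 1 := by
  have h0 : (0 : ℝ) ≤ (R.card : ℝ) / q := by positivity
  have h1 : (R.card : ℝ) / q ≤ 1 := div_le_one_of_le₀ (by exact_mod_cast hR) (by positivity)
  unfold fsub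
  split_ifs <;> rw [abs_le] <;> constructor <;> linarith

lemma corrK_nonneg (R : Finset ℕ) (q k : ℕ) : 0 ≤ corrK R q k := by
  apply Real.sSup_nonneg
  rintro x ⟨M, d, -, -, -, -, rfl⟩
  exact abs_nonneg _

lemma corrMeasure_nonneg (R : Finset ℕ) (q s : ℕ) : 0 ≤ corrMeasure R q s := by
  apply Real.sSup_nonneg
  rintro x ⟨k, -, -, rfl⟩
  exact corrK_nonneg R q k

lemma corrK_le_corrMeasure (R : Finset ℕ) (q : ℕ) {k s : ℕ} (hk : 1 ≤ k) (hks : k ≤ s) :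
    corrK R q k ≤ corrMeasure R q s := by
  refine le_csSup (Set.Finite.bddAbove ?_) ⟨k, hk, hks, rfl⟩
  refine ((Set.finite_Icc 1 s).image (corrK R q)).subset ?_
  rintro x ⟨j, hj, hjs, rfl⟩
  exact ⟨j, ⟨hj, hjs⟩, rfl⟩

lemma abs_sum_prod_fsub_le_corrK {q : ℕ} {R : Finset ℕ} (hR : R.card ≤ q) {M : ℕ} (hM : 1 ≤ M)
    (hMq : M ≤ q) (S : Finset ℕ) (hS : ∀ j ∈ S, j ≤ q - 1) :
    |∑ n ∈ range M, ∏ j ∈ S, fsub q R (n + j)| ≤ corrK R q S.card := by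
  refine le_csSup ⟨q, ?_⟩ ⟨M, S.orderEmbOfFin rfl, hM, hMq, (S.orderEmbOfFin rfl).strictMono,
    fun i => hS _ (S.orderEmbOfFin_mem rfl i), ?_⟩
  · rintro x ⟨M', d, -, hM', -, -, rfl⟩
    calc |∑ n ∈ range M', ∏ i, fsub q R (n + d i)|
        ≤ ∑ n ∈ range M', |∏ i, fsub q R (n + d i)| := abs_sum_le_sum_abs _ _
      _ ≤ ∑ n ∈ range M', (1 : ℝ) := by
          refine sum_le_sum fun n _ => ?_
          rw [abs_prod]
          exact prod_le_one (fun _ _ => abs_nonneg _) fun _ _ => abs_fsub_le_one hR _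
      _ ≤ q := by simpa using hM'
  · congr 1
    refine sum_congr rfl fun n _ => ?_
    conv_lhs => rw [← S.map_orderEmbOfFin_univ rfl, prod_map]
    rfl

/-- The number of windows of length `W` in which `R` has the shape `P`, up to the correlation
measure of `R`. -/
lemma abs_card_window_sub_le {q : ℕ} {R : Finset ℕ} (hR : R.card ≤ q) {W s : ℕ} (hWq : W < q)
    (hWs : W ≤ s) (P : Finset ℕ) :
    |(((range (q - W)).filter (fun y => ∀ j < W, (y + j ∈ R ↔ j ∈ P))).card : ℝ) -
      (q - W : ℕ) * ∏ j ∈ range W, (if j ∈ P then (R.card : ℝ) / q else 1 - (R.card : ℝ) / q)|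
      ≤ 2 ^ W * corrMeasure R q s := by
  set δ : ℝ := (R.card : ℝ) / q with hδ
  set c : ℕ → ℝ := fun j => if j ∈ P then δ else 1 - δ with hc
  set e : ℕ → ℝ := fun j => if j ∈ P then 1 else -1 with he
  have h0 : (0 : ℝ) ≤ δ := by positivity
  have h1 : δ ≤ 1 := div_le_one_of_le₀ (by exact_mod_cast hR) (by positivity)
  have hc1 : ∀ j, |c j| ≤ 1 := by
    intro j
    simp only [hc]
    split_ifs <;> rw [abs_le] <;> constructor <;> linarith
  have he1 : ∀ j, |e j| ≤ 1 := by
    intro j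
    simp only [he]
    split_ifs <;> simp
  have hind : (((range (q - W)).filter (fun y => ∀ j < W, (y + j ∈ R ↔ j ∈ P))).card : ℝ) =
      ∑ y ∈ range (q - W), ∏ j ∈ range W, (e j * fsub q R (y + j) + c j) := by
    rw [card_filter, Nat.cast_sum]
    refine sum_congr rfl fun y hy => ?_
    have hfac : ∀ j ∈ range W, e j * fsub q R (y + j) + c j =
        if (y + j ∈ R ↔ j ∈ P) then 1 else 0 := by
      intro j hj
      rw [mem_range] at hy hj
      have hmod : (y + j) % q = y + j := Nat.mod_eq_of_lt (by omega)
      simp only [he, hc, fsub, hmod, ← hδ]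
      by_cases hjP : j ∈ P <;> by_cases hyR : y + j ∈ R <;> simp [hjP, hyR]
    rw [prod_congr rfl hfac, prod_ite_zero]
    simp
  have hexp : ∀ y, ∏ j ∈ range W, (e j * fsub q R (y + j) + c j) =
      ∑ S ∈ (range W).powerset, ((∏ j ∈ S, e j) * ∏ j ∈ range W \ S, c j) *
        ∏ j ∈ S, fsub q R (y + j) := by
    intro y
    rw [prod_add]
    refine sum_congr rfl fun S _ => ?_
    rw [prod_mul_distrib]
    ring
  have hempty : (∅ : Finset ℕ) ∈ (range W).powerset := empty_mem_powerset _
  have hmain : (((range (q - W)).filter (fun y => ∀ j < W, (y + j ∈ R ↔ j ∈ P))).card : ℝ) -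
      (q - W : ℕ) * ∏ j ∈ range W, c j = ∑ S ∈ (range W).powerset.erase ∅,
        ((∏ j ∈ S, e j) * ∏ j ∈ range W \ S, c j) *
          ∑ y ∈ range (q - W), ∏ j ∈ S, fsub q R (y + j) := by
    rw [hind, sum_congr rfl fun y _ => hexp y, sum_comm, ← add_sum_erase _ _ hempty]
    simp [mul_sum]
  rw [hmain]
  calc _ ≤ ∑ S ∈ (range W).powerset.erase ∅, |((∏ j ∈ S, e j) * ∏ j ∈ range W \ S, c j) *
          ∑ y ∈ range (q - W), ∏ j ∈ S, fsub q R (y + j)| := abs_sum_le_sum_abs _ _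
    _ ≤ ∑ S ∈ (range W).powerset.erase ∅, corrMeasure R q s := by
        refine sum_le_sum fun S hS => ?_
        rw [mem_erase, mem_powerset] at hS
        have hcard : S.card ≤ W := by simpa using card_le_card hS.2
        have hsum : |∑ y ∈ range (q - W), ∏ j ∈ S, fsub q R (y + j)| ≤ corrMeasure R q s :=
          (abs_sum_prod_fsub_le_corrK hR (by omega) (by omega) S fun j hj => by
            have := mem_range.1 (hS.2 hj)
            omega).trans
          (corrK_le_corrMeasure R q (card_pos.2 (nonempty_iff_ne_empty.2 hS.1))
            (hcard.trans hWs))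
        rw [abs_mul, abs_mul, abs_prod, abs_prod]
        have hep : ∏ j ∈ S, |e j| ≤ 1 := prod_le_one (fun _ _ => abs_nonneg _) fun j _ => he1 j
        have hcp : ∏ j ∈ range W \ S, |c j| ≤ 1 :=
          prod_le_one (fun _ _ => abs_nonneg _) fun j _ => hc1 j
        have hec : (∏ j ∈ S, |e j|) * ∏ j ∈ range W \ S, |c j| ≤ 1 :=
          mul_le_one₀ hep (prod_nonneg fun _ _ => abs_nonneg _) hcp
        exact (mul_le_of_le_one_left (abs_nonneg _) hec).trans hsum
    _ ≤ 2 ^ W * corrMeasure R q s := by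
        rw [sum_const, nsmul_eq_mul]
        refine mul_le_mul_of_nonneg_right ?_ (corrMeasure_nonneg R q s)
        have : ((range W).powerset.erase ∅).card ≤ 2 ^ W := by
          simp
        exact_mod_cast this

lemma tendsto_card_window {R : ℕ → Finset ℕ} {s : ℕ → ℕ} {δ : ℝ}
    (hR : ∀ q, (R q).card ≤ q) (hs : Tendsto s atTop atTop)
    (hδ : Tendsto (fun q : ℕ => ((R q).card : ℝ) / q) atTop (nhds δ))
    (hC : Tendsto (fun q : ℕ => corrMeasure (R q) q (s q) / q) atTop (nhds 0))
    (W : ℕ) (P : Finset ℕ) :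
    Tendsto (fun q : ℕ =>
      (((range (q - W)).filter (fun y => ∀ j < W, (y + j ∈ R q ↔ j ∈ P))).card : ℝ) / q)
      atTop (nhds (∏ j ∈ range W, if j ∈ P then δ else 1 - δ)) := by
  have hprod : Tendsto (fun q : ℕ => ∏ j ∈ range W,
      (if j ∈ P then ((R q).card : ℝ) / q else 1 - ((R q).card : ℝ) / q)) atTop
      (nhds (∏ j ∈ range W, if j ∈ P then δ else 1 - δ)) := by
    refine tendsto_finsetProd _ fun j _ => ?_
    by_cases hj : j ∈ P
    · simpa only [hj, if_true] using hδ
    · simpa only [hj, if_false] using hδ.const_sub 1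
  have hratio : Tendsto (fun q : ℕ => ((q - W : ℕ) : ℝ) / q) atTop (nhds 1) := by
    have h : Tendsto (fun q : ℕ => 1 - (W : ℝ) / q) atTop (nhds (1 - 0)) :=
      (tendsto_const_div_atTop_nhds_zero_nat (W : ℝ)).const_sub 1
    rw [sub_zero] at h
    refine h.congr' ?_
    filter_upwards [eventually_gt_atTop W] with q hq
    have hq0 : (q : ℝ) ≠ 0 := by
      have : 0 < q := by omega
      positivity
    rw [Nat.cast_sub hq.le, sub_div, div_self hq0]
  have hmain := hratio.mul hprod
  rw [one_mul] at hmain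
  have herr : Tendsto (fun q : ℕ => 2 ^ W * (corrMeasure (R q) q (s q) / q)) atTop (nhds 0) := by
    simpa using hC.const_mul ((2 : ℝ) ^ W)
  have hdiff := squeeze_zero_norm' (a := fun q : ℕ => 2 ^ W * (corrMeasure (R q) q (s q) / q))
    (f := fun q : ℕ =>
      (((range (q - W)).filter (fun y => ∀ j < W, (y + j ∈ R q ↔ j ∈ P))).card : ℝ) / q -
      ((q - W : ℕ) : ℝ) / q * ∏ j ∈ range W,
        (if j ∈ P then ((R q).card : ℝ) / q else 1 - ((R q).card : ℝ) / q)) ?_ herr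
  · simpa using hdiff.add hmain
  · filter_upwards [eventually_gt_atTop W, hs.eventually_ge_atTop W] with q hq hsq
    have hb := abs_card_window_sub_le (hR q) hq hsq P
    rw [Real.norm_eq_abs, div_mul_eq_mul_div, ← sub_div, abs_div, Nat.abs_cast, ← mul_div_assoc]
    exact div_le_div_of_nonneg_right hb (by positivity)

/-- In an increasing enumeration, two members with no member strictly between them are
consecutive. -/
lemma enumeration_succ_eq {T : ℕ} {x : ℕ → ℕ} (hmono : ∀ i j, i < j → j < T → x i < x j)
    {n g : ℕ} (hn : n < T) (hg : 0 < g) (hmem : x n + g ∈ (range T).image x)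
    (hgap : ∀ j, 0 < j → j < g → x n + j ∉ (range T).image x) :
    n + 1 < T ∧ x (n + 1) = x n + g := by
  obtain ⟨k, hk, hxk⟩ := mem_image.1 hmem
  rw [mem_range] at hk
  have hnk : n < k := by
    by_contra! h
    rcases h.eq_or_lt with rfl | h
    · omega
    · have := hmono k n h hn
      omega
  have hn1 : n + 1 < T := by omega
  refine ⟨hn1, ?_⟩
  rcases (show n + 1 ≤ k from hnk).eq_or_lt with rfl | h
  · exact hxk
  · exfalso
    have h1 := hmono n (n + 1) (by omega) hn1
    have h2 := hmono (n + 1) k h hk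
    refine hgap (x (n + 1) - x n) (by omega) (by omega) ?_
    rw [show x n + (x (n + 1) - x n) = x (n + 1) by omega]
    exact mem_image_of_mem x (mem_range.2 hn1)

/-- Windows whose members sit exactly at the partial sums `σ 0 = 0 < σ 1 < ⋯ < σ ℓ` inject into
runs of consecutive members with the corresponding gaps. -/
lemma card_window_le_card_gaps {T q ℓ : ℕ} {x : ℕ → ℕ}
    (hmono : ∀ i j, i < j → j < T → x i < x j) {σ : ℕ → ℕ} (hσ0 : σ 0 = 0) (hσ : StrictMono σ) :
    ((range (q - (σ ℓ + 1))).filter (fun y => ∀ j < σ ℓ + 1,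
        (y + j ∈ (range T).image x ↔ j ∈ (range (ℓ + 1)).image σ))).card ≤
      ((range (T - ℓ)).filter (fun n => ∀ i : Fin ℓ,
        x (n + i + 1) = x (n + i) + (σ (i + 1) - σ i))).card := by
  refine (card_le_card ?_).trans (card_image_le (f := x))
  intro y hy
  rw [mem_filter] at hy
  have hy := hy.2
  have hy0 : y ∈ (range T).image x :=
    (hy 0 (by omega)).2 (mem_image.2 ⟨0, by simp, hσ0⟩)
  obtain ⟨n, hn, rfl⟩ := mem_image.1 hy0
  rw [mem_range] at hn
  have key : ∀ i, i ≤ ℓ → n + i < T ∧ x (n + i) = x n + σ i := by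
    intro i
    induction i with
    | zero => intro _; simp [hn, hσ0]
    | succ i ih =>
      intro hi
      obtain ⟨hiT, hxi⟩ := ih (by omega)
      have hlt : σ i < σ (i + 1) := hσ (Nat.lt_succ_self i)
      have hle : σ (i + 1) ≤ σ ℓ := hσ.monotone hi
      have hstep := enumeration_succ_eq hmono hiT (g := σ (i + 1) - σ i) (by omega) ?_ ?_
      · rw [← add_assoc]
        exact ⟨hstep.1, by omega⟩
      · rw [show x (n + i) + (σ (i + 1) - σ i) = x n + σ (i + 1) by omega]
        exact (hy _ (by omega)).2 (mem_image_of_mem σ (mem_range.2 (by omega)))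
      · intro j hj0 hj
        rw [hxi, add_assoc, hy _ (by omega)]
        intro hmem
        obtain ⟨k, -, hk⟩ := mem_image.1 hmem
        have h1 : i < k := hσ.lt_iff_lt.1 (by omega)
        have h2 : k < i + 1 := hσ.lt_iff_lt.1 (by omega)
        omega
  refine mem_image_of_mem x (mem_filter.2 ⟨mem_range.2 ?_, fun i => ?_⟩)
  · have := (key ℓ le_rfl).1
    omega
  · have h1 := (key i i.2.le).2
    have h2 := (key (i + 1) i.2).2
    have hlt : σ i < σ (i + 1) := hσ (Nat.lt_succ_self _)
    rw [← add_assoc] at h2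
    omega

lemma prod_window_eq (δ : ℝ) {σ : ℕ → ℕ} (hσ : StrictMono σ) (ℓ : ℕ) :
    ∏ j ∈ range (σ ℓ + 1), (if j ∈ (range (ℓ + 1)).image σ then δ else 1 - δ) =
      δ ^ (ℓ + 1) * (1 - δ) ^ (σ ℓ - ℓ) := by
  have hsub : (range (ℓ + 1)).image σ ⊆ range (σ ℓ + 1) := by
    intro j hj
    obtain ⟨i, hi, rfl⟩ := mem_image.1 hj
    have := hσ.monotone (Nat.lt_succ_iff.1 (mem_range.1 hi))
    exact mem_range.2 (by omega)
  have hcard : ((range (ℓ + 1)).image σ).card = ℓ + 1 := by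
    rw [card_image_of_injective _ hσ.injective, card_range]
  rw [prod_ite, prod_const, prod_const, filter_mem_eq_inter, inter_eq_right.2 hsub,
    filter_notMem_eq_sdiff, card_sdiff_of_subset hsub, hcard, card_range]
  congr 2
  omega

/-- Pattern densities bounded below by `c` and of total mass at most `1 = |B| c` converge to
`c`. -/
lemma tendsto_of_eventually_lower_of_sum_le {ι : Type*} (B : Finset ι) (a : ι → ℕ → ℝ) {c : ℝ}
    (hc : (B.card : ℝ) * c = 1)
    (hlow : ∀ b ∈ B, ∀ ε > 0, ∀ᶠ q in atTop, c - ε < a b q)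
    (hsum : ∀ᶠ q in atTop, ∑ b ∈ B, a b q ≤ 1) {b : ι} (hb : b ∈ B) :
    Tendsto (a b) atTop (nhds c) := by
  classical
  rw [Metric.tendsto_nhds]
  intro ε hε
  have hB : (0 : ℝ) < B.card := by exact_mod_cast card_pos.2 ⟨b, hb⟩
  have hall : ∀ᶠ q in atTop, ∀ b' ∈ B, c - ε / B.card < a b' q :=
    (eventually_all_finset B).2 fun b' hb' => hlow b' hb' _ (by positivity)
  filter_upwards [hall, hsum, hlow b hb ε hε] with q hq hs hl
  rw [Real.dist_eq, abs_lt]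
  refine ⟨by linarith, ?_⟩
  have h1 : ∑ b' ∈ B.erase b, (c - ε / B.card) ≤ ∑ b' ∈ B.erase b, a b' q :=
    sum_le_sum fun b' hb' => (hq b' (mem_of_mem_erase hb')).le
  rw [← add_sum_erase _ _ hb] at hs
  rw [sum_const, nsmul_eq_mul, card_erase_of_mem hb, Nat.cast_pred (card_pos.2 ⟨b, hb⟩)] at h1
  have h2 : (B.card : ℝ) * (ε / B.card) = ε := by field_simp
  have h3 : 0 < ε / B.card := by positivity
  nlinarith

lemma sum_Ico_geom (r : ℝ) {a b : ℕ} (hab : a ≤ b) :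
    ∑ i ∈ Ico a b, (1 - r) * r ^ i = r ^ a - r ^ b := by
  induction b, hab using Nat.le_induction with
  | base => simp
  | succ b hb ih => rw [sum_Ico_succ_top hb, ih]; ring

/-- The set of `n` for which the gaps `x (n + i + 1) - x (n + i)` are `g i + 1`. -/
def gapSet (T ℓ : ℕ) (x : ℕ → ℕ) (g : Fin ℓ → ℕ) : Finset ℕ :=
  (range (T - ℓ)).filter (fun n => ∀ i : Fin ℓ, x (n + i + 1) = x (n + i) + (g i + 1))

lemma exists_tendsto_le_gap_density {T : ℕ → ℕ} {x : ℕ → ℕ → ℕ} {δ : ℝ} (hδ0 : 0 < δ)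
    (hmono : ∀ q i j, i < j → j < T q → x q i < x q j)
    (hT : Tendsto (fun q : ℕ => (T q : ℝ) / q) atTop (nhds δ))
    (hwin : ∀ (W : ℕ) (P : Finset ℕ), Tendsto (fun q : ℕ =>
      (((range (q - W)).filter
        (fun y => ∀ j < W, (y + j ∈ (range (T q)).image (x q) ↔ j ∈ P))).card : ℝ) / q)
      atTop (nhds (∏ j ∈ range W, if j ∈ P then δ else 1 - δ)))
    {ℓ : ℕ} (g : Fin ℓ → ℕ) :
    ∃ w : ℕ → ℝ, (∀ q, w q ≤ ((gapSet (T q) ℓ (x q) g).card : ℝ) / T q) ∧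
      Tendsto w atTop (nhds (∏ i, δ * (1 - δ) ^ g i)) := by
  set g' : ℕ → ℕ := fun i => if h : i < ℓ then g ⟨i, h⟩ else 0 with hg'
  set σ : ℕ → ℕ := fun k => ∑ i ∈ range k, (g' i + 1) with hσdef
  have hsucc : ∀ i, σ (i + 1) = σ i + (g' i + 1) := fun i => sum_range_succ _ _
  have hσ : StrictMono σ := strictMono_nat_of_lt_succ fun i => by rw [hsucc]; omega
  have hg'i : ∀ i : Fin ℓ, g' i = g i := fun i => by simp [hg']
  have hσℓ : σ ℓ - ℓ = ∑ i, g i := by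
    simp only [hσdef, sum_add_distrib, sum_const, card_range, smul_eq_mul, mul_one,
      Nat.add_sub_cancel]
    rw [sum_range]
    exact sum_congr rfl fun i _ => hg'i i
  refine ⟨fun q => (((range (q - (σ ℓ + 1))).filter (fun y => ∀ j < σ ℓ + 1,
      (y + j ∈ (range (T q)).image (x q) ↔ j ∈ (range (ℓ + 1)).image σ))).card : ℝ) / T q,
    fun q => ?_, ?_⟩
  · refine div_le_div_of_nonneg_right ?_ (by positivity)
    have h := card_window_le_card_gaps (q := q) (ℓ := ℓ) (hmono q) (by simp [hσdef]) hσ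
    simp only [hsucc, Nat.add_sub_cancel_left, hg'i] at h
    exact_mod_cast h
  · have h := (hwin (σ ℓ + 1) ((range (ℓ + 1)).image σ)).div hT hδ0.ne'
    rw [prod_window_eq δ hσ, hσℓ] at h
    have hlim : δ ^ (ℓ + 1) * (1 - δ) ^ (∑ i, g i) / δ = ∏ i, δ * (1 - δ) ^ g i := by
      rw [prod_mul_distrib, prod_const, prod_pow_eq_pow_sum, card_univ, Fintype.card_fin]
      field_simp
      ring
    rw [hlim] at h
    refine h.congr' ?_
    filter_upwards [eventually_gt_atTop 0] with q hq
    have hq0 : (q : ℝ) ≠ 0 := by positivity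
    simp only [Pi.div_apply]
    rw [div_div_div_cancel_right₀ hq0]

/-- The set of `n` at which the sequence recording the gaps of length at most `m - 1` has the
pattern `b`. -/
def patternSet (T m ℓ : ℕ) (x : ℕ → ℕ) (b : Fin ℓ → ℕ) : Finset ℕ :=
  (range (T - ℓ)).filter (fun n => ∀ i : Fin ℓ,
    (if 1 ≤ x (n + (i : ℕ) + 1) - x (n + (i : ℕ)) ∧
        x (n + (i : ℕ) + 1) - x (n + (i : ℕ)) ≤ m - 1 then 1 else 0) = b i)

lemma sum_card_gapSet_le (T m ℓ L : ℕ) (x : ℕ → ℕ) (b : Fin ℓ → ℕ) (hb : ∀ i, b i ≤ 1) :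
    ∑ g ∈ Fintype.piFinset (fun i => if b i = 1 then range (m - 1) else Ico (m - 1) L),
      (gapSet T ℓ x g).card ≤ (patternSet T m ℓ x b).card := by
  rw [← card_biUnion]
  · refine card_le_card fun n hn => ?_
    obtain ⟨g, hg, hn⟩ := mem_biUnion.1 hn
    obtain ⟨hnT, hn⟩ := mem_filter.1 hn
    refine mem_filter.2 ⟨hnT, fun i => ?_⟩
    have hgi := Fintype.mem_piFinset.1 hg i
    have hbi := hb i
    rw [hn i, Nat.add_sub_cancel_left]
    by_cases h : b i = 1
    · simp only [h, if_true, mem_range] at hgi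
      rw [if_pos (by omega), h]
    · simp only [h, if_false, mem_Ico] at hgi
      rw [if_neg (by omega)]
      omega
  · intro g _ g' _ hne
    refine disjoint_left.2 fun n hn hn' => hne (funext fun i => ?_)
    have h := (mem_filter.1 hn).2 i
    have h' := (mem_filter.1 hn').2 i
    omega

lemma sum_card_patternSet_le (T m ℓ : ℕ) (x : ℕ → ℕ) (B : Finset (Fin ℓ → ℕ)) :
    ∑ b ∈ B, (patternSet T m ℓ x b).card ≤ T := by
  rw [← card_biUnion]
  · calc _ ≤ (range (T - ℓ)).card :=
          card_le_card (biUnion_subset.2 fun b _ => filter_subset _ _)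
      _ ≤ T := by simp
  · intro b _ b' _ hne
    refine disjoint_left.2 fun n hn hn' => hne (funext fun i => ?_)
    rw [← (mem_filter.1 hn).2 i, (mem_filter.1 hn').2 i]

lemma eventually_lt_pattern_density {T : ℕ → ℕ} {x : ℕ → ℕ → ℕ} {δ : ℝ} (hδ0 : 0 < δ)
    (hδ1 : δ < 1) {m ℓ : ℕ} (hδm : (1 - δ) ^ (m - 1) = 1 / 2)
    (hgap : ∀ g : Fin ℓ → ℕ, ∃ w : ℕ → ℝ,
      (∀ q, w q ≤ ((gapSet (T q) ℓ (x q) g).card : ℝ) / T q) ∧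
      Tendsto w atTop (nhds (∏ i, δ * (1 - δ) ^ g i)))
    (b : Fin ℓ → ℕ) (hb : ∀ i, b i ≤ 1) {ε : ℝ} (hε : 0 < ε) :
    ∀ᶠ q in atTop, 1 / 2 ^ ℓ - ε < ((patternSet (T q) m ℓ (x q) b).card : ℝ) / T q := by
  have hL : Tendsto (fun L : ℕ => ∏ i, (if b i = 1 then (1 : ℝ) / 2 else 1 / 2 - (1 - δ) ^ L))
      atTop (nhds (∏ _i : Fin ℓ, (1 : ℝ) / 2)) := by
    refine tendsto_finsetProd _ fun i _ => ?_
    by_cases h : b i = 1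
    · simp only [h, if_true]
      exact tendsto_const_nhds
    · simp only [h, if_false]
      simpa using (tendsto_pow_atTop_nhds_zero_of_lt_one (r := 1 - δ) (by linarith)
        (by linarith)).const_sub (1 / 2 : ℝ)
  have hprod : (∏ _i : Fin ℓ, (1 : ℝ) / 2) = 1 / 2 ^ ℓ := by simp
  rw [hprod] at hL
  obtain ⟨L, hLε, hLm⟩ := ((hL.eventually_const_lt (sub_lt_self _ hε)).and
    (eventually_ge_atTop (m - 1))).exists
  choose w hw hwlim using hgap
  set F := Fintype.piFinset (fun i => if b i = 1 then range (m - 1) else Ico (m - 1) L) with hF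
  have hlim : Tendsto (fun q => ∑ g ∈ F, w g q) atTop
      (nhds (∏ i, (if b i = 1 then (1 : ℝ) / 2 else 1 / 2 - (1 - δ) ^ L))) := by
    have h := tendsto_finsetSum F fun g _ => hwlim g
    rw [hF, ← prod_univ_sum _ (fun _ k => δ * (1 - δ) ^ k)] at h
    convert h using 3 with i
    · split_ifs
      · have := sum_Ico_geom (1 - δ) (Nat.zero_le (m - 1))
        rw [Nat.Ico_zero_eq_range, sub_sub_cancel, hδm] at this
        rw [this]
        norm_num
      · have := sum_Ico_geom (1 - δ) hLm
        rw [sub_sub_cancel, hδm] at this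
        rw [this]
  filter_upwards [hlim.eventually_const_lt hLε] with q hq
  refine hq.trans_le ((sum_le_sum fun g _ => hw g q).trans ?_)
  rw [← sum_div, ← Nat.cast_sum]
  exact div_le_div_of_nonneg_right
    (by exact_mod_cast sum_card_gapSet_le (T q) m ℓ L (x q) b hb) (by positivity)

lemma two_rpow_neg_inv_lt_one_and_pow_eq {m : ℕ} (hm : 2 ≤ m) :
    (2 : ℝ) ^ (-(1 / ((m : ℝ) - 1))) < 1 ∧
      ((2 : ℝ) ^ (-(1 / ((m : ℝ) - 1)))) ^ (m - 1) = 1 / 2 := by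
  have hm2 : (2 : ℝ) ≤ m := by exact_mod_cast hm
  have hm1 : (0 : ℝ) < m - 1 := by linarith
  constructor
  · exact Real.rpow_lt_one_of_one_lt_of_neg one_lt_two (by simpa using hm1)
  · rw [← Real.rpow_natCast, ← Real.rpow_mul two_pos.le, Nat.cast_sub (by omega), Nat.cast_one,
      neg_mul, one_div_mul_cancel hm1.ne', Real.rpow_neg_one]
    norm_num

theorem statement8 (m ℓ : ℕ) (hm : 2 ≤ m) (hℓ : 1 ≤ ℓ)
    (T : ℕ → ℕ) (x : ℕ → ℕ → ℕ)
    (hmono : ∀ q i j, i < j → j < T q → x q i < x q j)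
    (hrange : ∀ q i, i < T q → x q i < q)
    (hupper : ∀ q, T q ≤ q)
    (hlower : ∀ᶠ q : ℕ in Filter.atTop,
      Real.log (Real.log (Real.log q)) / Real.log (Real.log q) * q ≤ (T q : ℝ))
    (hT : Filter.Tendsto (fun q : ℕ => (T q : ℝ) / q) Filter.atTop
      (nhds (1 - (2 : ℝ) ^ (-(1 / ((m : ℝ) - 1))))))
    (hC : Filter.Tendsto
      (fun q : ℕ => corrMeasure ((Finset.range (T q)).image (x q)) q
          (⌊(ℓ : ℝ) * Real.log (Real.log q)⌋₊) * Real.log q ^ ℓ / T q)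
      Filter.atTop (nhds 0)) :
    ∀ b : Fin ℓ → ℕ, (∀ i, b i ≤ 1) →
      Filter.Tendsto
        (fun q : ℕ => (((Finset.range (T q - ℓ)).filter
            (fun n => ∀ i : Fin ℓ,
              (if 1 ≤ x q (n + (i : ℕ) + 1) - x q (n + (i : ℕ)) ∧
                  x q (n + (i : ℕ) + 1) - x q (n + (i : ℕ)) ≤ m - 1
                then 1 else 0) = b i)).card : ℝ) / T q)
        Filter.atTop (nhds (1 / 2 ^ ℓ)) := by
  obtain ⟨hr1, hrm⟩ := two_rpow_neg_inv_lt_one_and_pow_eq hm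
  have hr0 : (0 : ℝ) < (2 : ℝ) ^ (-(1 / ((m : ℝ) - 1))) := by positivity
  set δ : ℝ := 1 - (2 : ℝ) ^ (-(1 / ((m : ℝ) - 1))) with hδ
  have hδ0 : 0 < δ := by linarith
  have hδm : (1 - δ) ^ (m - 1) = 1 / 2 := by rw [hδ, sub_sub_cancel, hrm]
  have hcard : ∀ q, ((range (T q)).image (x q)).card = T q := by
    intro q
    rw [card_image_of_injOn, card_range]
    have hs : StrictMonoOn (x q) (range (T q)) := fun i _ j hj hij =>
      hmono q i j hij (mem_range.1 hj)
    exact hs.injOn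
  have hlog : Tendsto (fun q : ℕ => Real.log q) atTop atTop :=
    Real.tendsto_log_atTop.comp tendsto_natCast_atTop_atTop
  have hs : Tendsto (fun q : ℕ => ⌊(ℓ : ℝ) * Real.log (Real.log q)⌋₊) atTop atTop :=
    tendsto_nat_floor_atTop.comp
      ((Real.tendsto_log_atTop.comp hlog).const_mul_atTop (by exact_mod_cast hℓ))
  have hC' : Tendsto (fun q : ℕ => corrMeasure ((range (T q)).image (x q)) q
      (⌊(ℓ : ℝ) * Real.log (Real.log q)⌋₊) / q) atTop (nhds 0) := by
    refine squeeze_zero' (Eventually.of_forall fun q =>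
      div_nonneg (corrMeasure_nonneg _ _ _) (by positivity)) ?_ hC
    filter_upwards [hT.eventually_const_lt hδ0, hlog.eventually_ge_atTop 1] with q hTq hlogq
    have hT0 : (0 : ℝ) < T q := by
      rcases Nat.eq_zero_or_pos (T q) with h | h
      · simp [h] at hTq
      · exact_mod_cast h
    have hTq' : (T q : ℝ) ≤ q := by exact_mod_cast hupper q
    exact div_le_div₀ (mul_nonneg (corrMeasure_nonneg _ _ _) (by positivity))
      (le_mul_of_one_le_right (corrMeasure_nonneg _ _ _) (one_le_pow₀ hlogq)) hT0 hTq'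
  have hwin := tendsto_card_window (R := fun q => (range (T q)).image (x q)) (δ := δ)
    (fun q => (hcard q).trans_le (hupper q)) hs (by simpa only [hcard] using hT) hC'
  have hmemB : ∀ b : Fin ℓ → ℕ, b ∈ Fintype.piFinset (fun _ : Fin ℓ => range 2) ↔
      ∀ i, b i ≤ 1 := fun b => by
    simp [Fintype.mem_piFinset]
  intro b hb
  refine tendsto_of_eventually_lower_of_sum_le (Fintype.piFinset (fun _ : Fin ℓ => range 2))
    (fun b q => ((patternSet (T q) m ℓ (x q) b).card : ℝ) / T q) ?_ (fun b' hb' ε hε => ?_) ?_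
    ((hmemB b).2 hb)
  · simp
  · exact eventually_lt_pattern_density hδ0 (by linarith) hδm
      (fun g => exists_tendsto_le_gap_density hδ0 hmono hT hwin g) b' ((hmemB b').1 hb') hε
  · refine Eventually.of_forall fun q => ?_
    rw [← sum_div, ← Nat.cast_sum]
    exact div_le_one_of_le₀ (by exact_mod_cast sum_card_patternSet_le _ _ _ _ _) (by positivity)
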